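/- Let s ∈ (0,1) and let p be a uniformly continuous symmetric function on ℝ^N×ℝ^N with 1 < p⁻ := inf p ≤ p⁺ := sup p < ∞ and s·p⁺ < N. Let r be a uniformly continuous function on ℝ^N with 1 < inf r ≤ sup r < ∞, p(x,x) ≤ r(x) for all x ∈ ℝ^N, and inf_{x∈ℝ^N}(p*_s(x) − r(x)) > 0, where p*_s(x) := N p(x,x)/(N − s p(x,x)). Then W^{s,p(·,·)}(ℝ^N) is continuously embedded in L^{r(·)}(ℝ^N): there exists C > 0 such that ‖u‖_{L^{r(·)}(ℝ^N)} ≤ C ‖u‖_{s,p,ℝ^N} for all u ∈ W^{s,p(·,·)}(ℝ^N). -/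

import Mathlib

open MeasureTheory Metric Set Filter
open scoped ENNReal NNReal

noncomputable section

/-- `Ω` is a (bounded or unbounded) Lipschitz domain in `ℝ^N`: it is open, nonempty, and near
every boundary point, after a rigid motion (an isometry of `ℝ^N`), `Ω` coincides with the strict
epigraph of a Lipschitz function of the first `N-1` coordinates. -/
def IsLipschitzDomain {N : ℕ} (Ω : Set (EuclideanSpace ℝ (Fin N))) : Prop :=
  IsOpen Ω ∧ Ω.Nonempty ∧
    ∀ z ∈ frontier Ω, ∃ r : ℝ, 0 < r ∧
      ∃ e : EuclideanSpace ℝ (Fin N) ≃ᵢ EuclideanSpace ℝ (Fin N),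
        ∃ L : NNReal, ∃ φ : EuclideanSpace ℝ (Fin N) → ℝ, LipschitzWith L φ ∧
          (∀ x y : EuclideanSpace ℝ (Fin N),
            (∀ i : Fin N, (i : ℕ) + 1 < N → x i = y i) → φ x = φ y) ∧
          ∀ hN : 0 < N, ∀ x ∈ Metric.ball z r,
            (x ∈ Ω ↔ φ (e x) < (e x) ⟨N - 1, Nat.sub_lt hN Nat.one_pos⟩)

/-- The modular `∫_Ω |u(x)|^{q(x)} dx` of the variable exponent Lebesgue space `L^{q(·)}(Ω)`. -/
def modLq {N : ℕ} (Ω : Set (EuclideanSpace ℝ (Fin N))) (q : EuclideanSpace ℝ (Fin N) → ℝ)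
    (u : EuclideanSpace ℝ (Fin N) → ℝ) : ℝ≥0∞ :=
  ∫⁻ x in Ω, ENNReal.ofReal (|u x| ^ q x)

/-- The Luxemburg norm `‖u‖_{L^{q(·)}(Ω)} = inf {λ > 0 : ∫_Ω |u(x)/λ|^{q(x)} dx ≤ 1}`. -/
def luxNorm {N : ℕ} (Ω : Set (EuclideanSpace ℝ (Fin N))) (q : EuclideanSpace ℝ (Fin N) → ℝ)
    (u : EuclideanSpace ℝ (Fin N) → ℝ) : ℝ :=
  sInf {l : ℝ | 0 < l ∧ modLq Ω q (fun x => u x / l) ≤ 1}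

/-- The Gagliardo modular
`∫_Ω ∫_Ω |u(x)-u(y)|^{p(x,y)} / |x-y|^{N+s·p(x,y)} dx dy` with variable exponent `p`. -/
def gagMod {N : ℕ} (Ω : Set (EuclideanSpace ℝ (Fin N))) (s : ℝ)
    (p : EuclideanSpace ℝ (Fin N) → EuclideanSpace ℝ (Fin N) → ℝ)
    (u : EuclideanSpace ℝ (Fin N) → ℝ) : ℝ≥0∞ :=
  ∫⁻ x in Ω, ∫⁻ y in Ω,
    ENNReal.ofReal (|u x - u y| ^ p x y / ‖x - y‖ ^ ((N : ℝ) + s * p x y))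

/-- The Gagliardo seminorm
`[u]_{s,p(·,·),Ω} = inf {λ > 0 : ∫_Ω ∫_Ω |u(x)-u(y)|^{p(x,y)}/(λ^{p(x,y)}|x-y|^{N+s p(x,y)}) < 1}`. -/
def gagSeminorm {N : ℕ} (Ω : Set (EuclideanSpace ℝ (Fin N))) (s : ℝ)
    (p : EuclideanSpace ℝ (Fin N) → EuclideanSpace ℝ (Fin N) → ℝ)
    (u : EuclideanSpace ℝ (Fin N) → ℝ) : ℝ :=
  sInf {l : ℝ | 0 < l ∧ gagMod Ω s p (fun x => u x / l) < 1}

/-- The norm `‖u‖_{s,q,p,Ω} = ‖u‖_{L^{q(·)}(Ω)} + [u]_{s,p(·,·),Ω}` of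
`W^{s,q(·),p(·,·)}(Ω)`. -/
def sobNorm {N : ℕ} (Ω : Set (EuclideanSpace ℝ (Fin N))) (q : EuclideanSpace ℝ (Fin N) → ℝ)
    (s : ℝ) (p : EuclideanSpace ℝ (Fin N) → EuclideanSpace ℝ (Fin N) → ℝ)
    (u : EuclideanSpace ℝ (Fin N) → ℝ) : ℝ :=
  luxNorm Ω q u + gagSeminorm Ω s p u

/-- Membership in `W^{s,q(·),p(·,·)}(Ω)`: `u` is measurable, lies in `L^{q(·)}(Ω)`, and its
Gagliardo modular is finite. -/
def memW {N : ℕ} (Ω : Set (EuclideanSpace ℝ (Fin N))) (q : EuclideanSpace ℝ (Fin N) → ℝ)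
    (s : ℝ) (p : EuclideanSpace ℝ (Fin N) → EuclideanSpace ℝ (Fin N) → ℝ)
    (u : EuclideanSpace ℝ (Fin N) → ℝ) : Prop :=
  Measurable u ∧ modLq Ω q u < ⊤ ∧ gagMod Ω s p u < ⊤

lemma abs_div_rpow_le {a l q : ℝ} (hl : 1 ≤ l) (hq : 1 ≤ q) :
    |a / l| ^ q ≤ l⁻¹ * |a| ^ q := by
  have hl0 : 0 < l := by linarith
  rw [abs_div, abs_of_pos hl0, Real.div_rpow (abs_nonneg a) hl0.le, div_eq_mul_inv, mul_comm]
  gcongr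
  exact Real.self_le_rpow_of_one_le hl hq

lemma modLq_div_le {N : ℕ} (Ω : Set (EuclideanSpace ℝ (Fin N)))
    {q : EuclideanSpace ℝ (Fin N) → ℝ} (hq : ∀ x, 1 ≤ q x)
    (u : EuclideanSpace ℝ (Fin N) → ℝ) {l : ℝ} (hl : 1 ≤ l) :
    modLq Ω q (fun x => u x / l) ≤ ENNReal.ofReal l⁻¹ * modLq Ω q u := by
  unfold modLq
  rw [← lintegral_const_mul' _ _ ENNReal.ofReal_ne_top]
  refine lintegral_mono fun x => ?_
  rw [← ENNReal.ofReal_mul (by positivity)]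
  exact ENNReal.ofReal_le_ofReal (abs_div_rpow_le hl (hq x))

lemma gagMod_div_le {N : ℕ} (Ω : Set (EuclideanSpace ℝ (Fin N))) (s : ℝ)
    {p : EuclideanSpace ℝ (Fin N) → EuclideanSpace ℝ (Fin N) → ℝ} (hp : ∀ x y, 1 ≤ p x y)
    (u : EuclideanSpace ℝ (Fin N) → ℝ) {l : ℝ} (hl : 1 ≤ l) :
    gagMod Ω s p (fun x => u x / l) ≤ ENNReal.ofReal l⁻¹ * gagMod Ω s p u := by
  unfold gagMod
  rw [← lintegral_const_mul' _ _ ENNReal.ofReal_ne_top]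
  refine lintegral_mono fun x => ?_
  rw [← lintegral_const_mul' _ _ ENNReal.ofReal_ne_top]
  refine lintegral_mono fun y => ?_
  rw [← ENNReal.ofReal_mul (by positivity)]
  refine ENNReal.ofReal_le_ofReal ?_
  rw [← sub_div, ← mul_div_assoc]
  exact div_le_div_of_nonneg_right (abs_div_rpow_le hl (hp x y)) (by positivity)

/-- Chebyshev's inequality on a ball on which the exponent is at least `c`. -/
lemma volume_ball_inter_lt_le {N : ℕ} {u σ : EuclideanSpace ℝ (Fin N) → ℝ} (hu : Measurable u)
    {A ρ m c : ℝ} {x : EuclideanSpace ℝ (Fin N)} (hm : 1 ≤ m)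
    (hc : 0 ≤ c)     (hσ : ∀ y ∈ ball x ρ, c ≤ σ y) (hA : modLq univ σ u ≤ ENNReal.ofReal A) :
    volume (ball x ρ ∩ {y | m < |u y|}) ≤ ENNReal.ofReal (A * m ^ (-c)) := by
  have hm0 : 0 < m := by linarith
  have hmeas : MeasurableSet (ball x ρ ∩ {y | m < |u y|}) :=
    measurableSet_ball.inter (measurableSet_lt measurable_const hu.abs)
  have h : ENNReal.ofReal (m ^ c) * volume (ball x ρ ∩ {y | m < |u y|}) ≤ ENNReal.ofReal A := by
    rw [← setLIntegral_const]
    calc _ ≤ ∫⁻ y in ball x ρ ∩ {y | m < |u y|}, ENNReal.ofReal (|u y| ^ σ y) := by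
          refine setLIntegral_mono' hmeas fun y hy => ENNReal.ofReal_le_ofReal ?_
          calc m ^ c ≤ m ^ σ y := Real.rpow_le_rpow_of_exponent_le hm (hσ y hy.1)
            _ ≤ |u y| ^ σ y := by
              exact Real.rpow_le_rpow hm0.le (le_of_lt hy.2) (hc.trans (hσ y hy.1))
      _ ≤ modLq univ σ u := by
          unfold modLq
          exact lintegral_mono_set (subset_univ _)
      _ ≤ _ := hA
  calc volume (ball x ρ ∩ {y | m < |u y|})
      = ENNReal.ofReal (m ^ (-c)) *
          (ENNReal.ofReal (m ^ c) * volume (ball x ρ ∩ {y | m < |u y|})) := by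
        rw [← mul_assoc, ← ENNReal.ofReal_mul (by positivity), ← Real.rpow_add hm0]
        simp
    _ ≤ ENNReal.ofReal (m ^ (-c)) * ENNReal.ofReal A := by gcongr
    _ = _ := by rw [← ENNReal.ofReal_mul (by positivity), mul_comm]

/-- A large value of `u` at `x` forces the inner integral of the Gagliardo modular at `x` to be
large, because `u` is smaller on at least half of a suitable ball around `x`. -/
lemma rpow_le_lintegral_gagliardo {N : ℕ} (hN : 0 < N) {s : ℝ} (hs0 : 0 < s)
    {p : EuclideanSpace ℝ (Fin N) → EuclideanSpace ℝ (Fin N) → ℝ}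
    {u σ : EuclideanSpace ℝ (Fin N) → ℝ} (hu : Measurable u)
    {K ω ρ₀ a c t m : ℝ} {x : EuclideanSpace ℝ (Fin N)}
    (hK : 1 ≤ K) (hω : 0 < ω) (hωv : volume (ball (0 : EuclideanSpace ℝ (Fin N)) 1) =
      ENNReal.ofReal ω)
    (hρ₀ : 0 < ρ₀) (hρ₁ : ρ₀ ≤ 1)
    (ha : 0 ≤ a) (hc : 1 ≤ c) (hsa : s * a ≤ N)
    (hpa : ∀ y ∈ ball x ρ₀, a ≤ p x y) (hσc : ∀ y ∈ ball x ρ₀, c ≤ σ y)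
    (hA : modLq univ σ u ≤ ENNReal.ofReal (K * ω / 2))
    (ht : t ≤ a * (1 + s * c / N))
    (hm : K / ρ₀ ^ N ≤ m) (hux : |u x| = 2 * m) :
    ENNReal.ofReal (m ^ t) ≤ ENNReal.ofReal (2 * K / ω) *
      ∫⁻ y, ENNReal.ofReal (|u x - u y| ^ p x y / ‖x - y‖ ^ ((N : ℝ) + s * p x y)) := by
  have hNR : (0 : ℝ) < N := by exact_mod_cast hN
  have hK0 : 0 < K := by linarith
  have hm1 : 1 ≤ m := by
    refine le_trans ?_ hm
    rw [le_div_iff₀ (by positivity), one_mul]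
    exact (pow_le_one₀ hρ₀.le hρ₁).trans hK
  have hm0 : 0 < m := by linarith
  set ρ : ℝ := (K * m ^ (-c)) ^ ((N : ℝ)⁻¹) with hρdef
  have hb : 0 < K * m ^ (-c) := by positivity
  have hρ : 0 < ρ := by positivity
  have hρN : ρ ^ N = K * m ^ (-c) := Real.rpow_inv_natCast_pow hb.le hN.ne'
  have hρle : ρ ≤ ρ₀ := by
    refine le_of_pow_le_pow_left₀ hN.ne' hρ₀.le ?_
    rw [hρN]
    calc K * m ^ (-c) ≤ K * m ^ (-1 : ℝ) := by
          gcongr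
      _ = K / m := by rw [Real.rpow_neg_one]; rfl
      _ ≤ ρ₀ ^ N := by
          rw [div_le_iff₀ hm0]
          rwa [div_le_iff₀ (by positivity), mul_comm] at hm
  have hρ1 : ρ ≤ 1 := hρle.trans hρ₁
  have hsub : ball x ρ ⊆ ball x ρ₀ := ball_subset_ball hρle
  set B := ball x ρ ∩ {y | m < |u y|} with hB
  have hBm : MeasurableSet B :=
    measurableSet_ball.inter (measurableSet_lt measurable_const hu.abs)
  have hBv : volume B ≤ ENNReal.ofReal (ω * ρ ^ N / 2) := by
    refine (volume_ball_inter_lt_le hu hm1 (by linarith) (fun y hy => hσc y (hsub hy)) hA).trans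
      (le_of_eq ?_)
    rw [hρN]
    congr 1
    ring
  have hball : volume (ball x ρ) = ENNReal.ofReal (ω * ρ ^ N) := by
    rw [Measure.addHaar_ball_of_pos _ _ hρ, hωv, finrank_euclideanSpace, Fintype.card_fin,
      ← ENNReal.ofReal_mul (by positivity), mul_comm]
  have hGv : ENNReal.ofReal (ω * ρ ^ N / 2) ≤ volume (ball x ρ \ B) := by
    refine le_trans ?_ le_measure_sdiff
    rw [hball]
    refine le_trans ?_ (tsub_le_tsub_left hBv _)
    rw [← ENNReal.ofReal_sub _ (by positivity)]
    refine ENNReal.ofReal_le_ofReal (by linarith)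
  have hint : ENNReal.ofReal (m ^ a / ρ ^ ((N : ℝ) + s * a)) * ENNReal.ofReal (ω * ρ ^ N / 2) ≤
      ∫⁻ y, ENNReal.ofReal (|u x - u y| ^ p x y / ‖x - y‖ ^ ((N : ℝ) + s * p x y)) := by
    calc _ ≤ ENNReal.ofReal (m ^ a / ρ ^ ((N : ℝ) + s * a)) * volume (ball x ρ \ B) := by gcongr
      _ = ∫⁻ y in ball x ρ \ B, ENNReal.ofReal (m ^ a / ρ ^ ((N : ℝ) + s * a)) :=
          (setLIntegral_const _ _).symm
      _ ≤ ∫⁻ y in ball x ρ \ B,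
          ENNReal.ofReal (|u x - u y| ^ p x y / ‖x - y‖ ^ ((N : ℝ) + s * p x y)) := by
          refine setLIntegral_mono' (measurableSet_ball.diff hBm) fun y hy =>
            ENNReal.ofReal_le_ofReal ?_
          have hyb : y ∈ ball x ρ := hy.1
          have huy : |u y| ≤ m := by
            by_contra! h
            exact hy.2 ⟨hyb, h⟩
          have hd : m ≤ |u x - u y| := by
            have := abs_sub_abs_le_abs_sub (u x) (u y)
            linarith
          have hap : a ≤ p x y := hpa y (hsub hyb)
          have hxy : 0 < ‖x - y‖ := by
            rw [norm_pos_iff, sub_ne_zero]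
            rintro rfl
            simp at hd
            linarith
          have hlt : ‖x - y‖ ≤ ρ := by
            rw [← dist_eq_norm, dist_comm]
            exact (mem_ball.1 hyb).le
          have h1 : m ^ a ≤ |u x - u y| ^ p x y :=
            (Real.rpow_le_rpow_of_exponent_le hm1 hap).trans
              (Real.rpow_le_rpow hm0.le hd (ha.trans hap))
          have hsp : s * a ≤ s * p x y := by gcongr
          have h2 : ‖x - y‖ ^ ((N : ℝ) + s * p x y) ≤ ρ ^ ((N : ℝ) + s * a) :=
            (Real.rpow_le_rpow hxy.le hlt (by nlinarith [mul_nonneg hs0.le ha])).trans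
              (Real.rpow_le_rpow_of_exponent_ge hρ hρ1 (by linarith))
          exact div_le_div₀ (by positivity) h1 (by positivity) h2
      _ ≤ _ := setLIntegral_le_lintegral _ _
  refine le_trans ?_ (mul_le_mul_right hint _)
  rw [← ENNReal.ofReal_mul (by positivity), ← ENNReal.ofReal_mul (by positivity)]
  refine ENNReal.ofReal_le_ofReal ?_
  have hρs : ρ ^ (s * a) = K ^ (s * a / N) * m ^ (-(c * (s * a / N))) := by
    rw [hρdef, ← Real.rpow_mul hb.le, Real.mul_rpow hK0.le (by positivity), ← Real.rpow_mul hm0.le]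
    congr 2 <;> ring
  have hKle : K ^ (s * a / N) ≤ K := by
    conv_rhs => rw [← Real.rpow_one K]
    exact Real.rpow_le_rpow_of_exponent_le hK ((div_le_one hNR).2 hsa)
  have hkey : 2 * K / ω * (m ^ a / ρ ^ ((N : ℝ) + s * a) * (ω * ρ ^ N / 2)) =
      K / K ^ (s * a / N) * m ^ (a * (1 + s * c / N)) := by
    have hexp : a * (1 + s * c / N) = a + c * (s * a / N) := by ring
    rw [Real.rpow_add hρ, Real.rpow_natCast, hρs, hexp, Real.rpow_add hm0, Real.rpow_neg hm0.le]
    field_simp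
  rw [hkey]
  calc m ^ t ≤ m ^ (a * (1 + s * c / N)) := Real.rpow_le_rpow_of_exponent_le hm1 ht
    _ ≤ _ := le_mul_of_one_le_left (by positivity) ((one_le_div (by positivity)).2 hKle)

/-- One step of the bootstrap: integrability with exponent `σ` improves to exponent `τ`. -/
lemma exists_modLq_le_of_modLq_le {N : ℕ} (hN : 0 < N) {s : ℝ} (hs0 : 0 < s)
    {p : EuclideanSpace ℝ (Fin N) → EuclideanSpace ℝ (Fin N) → ℝ}
    {P σ τ : EuclideanSpace ℝ (Fin N) → ℝ} (hP : Measurable P)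
    {η ρ₀ T : ℝ} (hρ₀ : 0 < ρ₀) (hρ₁ : ρ₀ ≤ 1)
    (hPη : ∀ x, 0 ≤ P x - η) (hσ : ∀ x, 1 ≤ σ x - η)
    (hsP : ∀ x, s * (P x - η) ≤ N)
    (hpball : ∀ x, ∀ y ∈ ball x ρ₀, P x - η ≤ p x y)
    (hσball : ∀ x, ∀ y ∈ ball x ρ₀, σ x - η ≤ σ y)
    (hP0 : ∀ x, 0 ≤ P x) (hPτ : ∀ x, P x ≤ τ x) (hτT : ∀ x, τ x ≤ T)
    (hτ : ∀ x, τ x ≤ (P x - η) * (1 + s * (σ x - η) / N)) (A : ℝ) :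
    ∃ A' : ℝ, ∀ u : EuclideanSpace ℝ (Fin N) → ℝ, Measurable u →
      modLq univ P u ≤ 1 → gagMod univ s p u ≤ 1 → modLq univ σ u ≤ ENNReal.ofReal A →
        modLq univ τ u ≤ ENNReal.ofReal A' := by
  set ω : ℝ := (volume (ball (0 : EuclideanSpace ℝ (Fin N)) 1)).toReal with hωdef
  have hωv : volume (ball (0 : EuclideanSpace ℝ (Fin N)) 1) = ENNReal.ofReal ω :=
    (ENNReal.ofReal_toReal measure_ball_lt_top.ne).symm
  have hω : 0 < ω :=
    ENNReal.toReal_pos (measure_ball_pos _ _ one_pos).ne' measure_ball_lt_top.ne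
  set K : ℝ := max 1 (2 * A / ω)
  have hK : 1 ≤ K := le_max_left _ _
  have hKA : A ≤ K * ω / 2 := by
    have : 2 * A / ω ≤ K := le_max_right _ _
    rw [div_le_iff₀ hω] at this
    linarith
  set m₀ : ℝ := K / ρ₀ ^ N with hm₀
  have hm₀1 : 1 ≤ m₀ := by
    rw [hm₀, le_div_iff₀ (by positivity), one_mul]
    exact (pow_le_one₀ hρ₀.le hρ₁).trans hK
  have hT : 0 ≤ T := (hP0 0).trans ((hPτ 0).trans (hτT 0))
  refine ⟨(2 * m₀) ^ T + 2 ^ T * (2 * K / ω), fun u hu hu1 hu2 hu3 => ?_⟩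
  have hC1 : 1 ≤ (2 * m₀) ^ T := Real.one_le_rpow (by linarith) hT
  have hpt : ∀ x, ENNReal.ofReal (|u x| ^ τ x) ≤
      ENNReal.ofReal ((2 * m₀) ^ T) * ENNReal.ofReal (|u x| ^ P x) +
      ENNReal.ofReal (2 ^ T * (2 * K / ω)) *
      ∫⁻ y, ENNReal.ofReal (|u x - u y| ^ p x y / ‖x - y‖ ^ ((N : ℝ) + s * p x y)) := by
    intro x
    have hτ0 : 0 ≤ τ x := (hP0 x).trans (hPτ x)
    rcases le_or_gt |u x| (2 * m₀) with h | h
    · refine le_trans ?_ le_self_add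
      rw [← ENNReal.ofReal_mul (by positivity)]
      refine ENNReal.ofReal_le_ofReal ?_
      rcases le_or_gt |u x| 1 with h1 | h1
      · refine le_trans ?_ (le_mul_of_one_le_left (by positivity) hC1)
        rcases (abs_nonneg (u x)).eq_or_lt with h0 | h0
        · rw [← h0]
          exact Real.rpow_le_rpow_of_exponent_ge_of_imp le_rfl zero_le_one (hPτ x)
            (fun _ h => le_antisymm (h ▸ hPτ x) (hP0 x))
        · exact Real.rpow_le_rpow_of_exponent_ge h0 h1 (hPτ x)
      · refine le_trans ?_ (le_mul_of_one_le_right (by positivity)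
          (Real.one_le_rpow h1.le (hP0 x)))
        exact (Real.rpow_le_rpow (abs_nonneg _) h hτ0).trans
          (Real.rpow_le_rpow_of_exponent_le (by linarith) (hτT x))
    · refine le_trans ?_ le_add_self
      have hux : |u x| = 2 * (|u x| / 2) := by ring
      have key := rpow_le_lintegral_gagliardo hN hs0 (p := p) (σ := σ) hu hK hω hωv hρ₀ hρ₁
        (hPη x) (hσ x) (hsP x) (hpball x) (hσball x)
        (hu3.trans (ENNReal.ofReal_le_ofReal hKA)) (hτ x)
        (show K / ρ₀ ^ N ≤ |u x| / 2 by linarith) hux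
      rw [ENNReal.ofReal_mul (by positivity), mul_assoc]
      refine le_trans ?_ (mul_le_mul_right key _)
      rw [← ENNReal.ofReal_mul (by positivity)]
      refine ENNReal.ofReal_le_ofReal ?_
      conv_lhs => rw [hux, Real.mul_rpow zero_le_two (by positivity)]
      gcongr
      · norm_num
      · exact hτT x
  have hmeas : Measurable fun x => ENNReal.ofReal (|u x| ^ P x) :=
    (hu.abs.pow hP).ennreal_ofReal
  simp only [modLq, gagMod, Measure.restrict_univ] at hu1 hu2 ⊢
  calc _ ≤ _ := lintegral_mono hpt
    _ = ENNReal.ofReal ((2 * m₀) ^ T) * (∫⁻ x, ENNReal.ofReal (|u x| ^ P x)) +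
        ENNReal.ofReal (2 ^ T * (2 * K / ω)) * ∫⁻ x, ∫⁻ y,
          ENNReal.ofReal (|u x - u y| ^ p x y / ‖x - y‖ ^ ((N : ℝ) + s * p x y)) := by
        rw [lintegral_add_left (hmeas.const_mul _), lintegral_const_mul' _ _ ENNReal.ofReal_ne_top,
          lintegral_const_mul' _ _ ENNReal.ofReal_ne_top]
    _ ≤ ENNReal.ofReal ((2 * m₀) ^ T) * 1 + ENNReal.ofReal (2 ^ T * (2 * K / ω)) * 1 := by gcongr
    _ = _ := by rw [mul_one, mul_one, ENNReal.ofReal_add (by positivity) (by positivity)]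

/-- The modular form of the embedding, by bootstrapping `min r (P + k * κ / 2)` in `k`. -/
lemma exists_modLq_le {N : ℕ} (hN : 0 < N) {s : ℝ} (hs0 : 0 < s) (hs1 : s < 1)
    {p : EuclideanSpace ℝ (Fin N) → EuclideanSpace ℝ (Fin N) → ℝ}
    (hp_uc : UniformContinuous
      (fun z : EuclideanSpace ℝ (Fin N) × EuclideanSpace ℝ (Fin N) => p z.1 z.2))
    {pm pM : ℝ} (hp_lb : 1 < pm) (hple : ∀ x y, pm ≤ p x y) (hpge : ∀ x y, p x y ≤ pM)
    (hp_ub : s * pM < N)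
    {r : EuclideanSpace ℝ (Fin N) → ℝ} (hr_uc : UniformContinuous r)
    {R : ℝ} (hrR : ∀ x, r x ≤ R) (hpr : ∀ x, p x x ≤ r x)
    {δ : ℝ} (hδ : 0 < δ) (hgap : ∀ x, r x + δ ≤ N * p x x / (N - s * p x x)) :
    ∃ A : ℝ, ∀ u : EuclideanSpace ℝ (Fin N) → ℝ, Measurable u →
      modLq univ (fun x => p x x) u ≤ 1 → gagMod univ s p u ≤ 1 →
        modLq univ r u ≤ ENNReal.ofReal A := by
  have hN1 : (1 : ℝ) ≤ N := by exact_mod_cast hN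
  have hNR : (0 : ℝ) < N := by linarith
  set P : EuclideanSpace ℝ (Fin N) → ℝ := fun x => p x x with hPdef
  have hP_uc : UniformContinuous P := hp_uc.comp (uniformContinuous_id.prodMk uniformContinuous_id)
  have hPpm : ∀ x, pm ≤ P x := fun x => hple x x
  have hsP : ∀ x, s * P x ≤ s * pM := fun x => mul_le_mul_of_nonneg_left (hpge x x) hs0.le
  have hR1 : 1 ≤ R := by linarith [hPpm 0, hpr 0, hrR 0]
  set κ : ℝ := (1 - s * pM / N) * δ with hκ
  have hκ0 : 0 < κ := mul_pos (by rw [sub_pos, div_lt_one hNR]; exact hp_ub) hδ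
  have hgain : ∀ x, ∀ σ ≤ r x, σ + κ ≤ P x * (1 + s * σ / N) := by
    intro x σ hσ
    have hd : 0 < N - s * P x := by linarith [hsP x]
    have h1 : (r x + δ) * (N - s * P x) ≤ N * P x := by
      have := hgap x
      rwa [le_div_iff₀ hd] at this
    have h2 : (σ + δ) * (N - s * P x) ≤ N * P x := le_trans (by gcongr) h1
    have h3 : (N - s * pM) * δ ≤ δ * (N - s * P x) := by nlinarith [hsP x]
    have h4 : N * (σ + κ) ≤ N * (P x * (1 + s * σ / N)) := by
      have e1 : N * κ = (N - s * pM) * δ := by rw [hκ]; field_simp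
      have e2 : N * (P x * (1 + s * σ / N)) = N * P x + P x * s * σ := by field_simp
      rw [mul_add, e1, e2]
      linarith
    exact le_of_mul_le_mul_left h4 hNR
  set η : ℝ := min (pm - 1) (κ / (2 * (2 + R))) with hη
  have hη0 : 0 < η := lt_min (by linarith) (by positivity)
  have hη1 : η ≤ pm - 1 := min_le_left _ _
  have hη2 : η * (2 + R) ≤ κ / 2 := by
    have : η ≤ κ / (2 * (2 + R)) := min_le_right _ _
    rw [le_div_iff₀ (by positivity)] at this
    linarith
  obtain ⟨ρp, hρp, hp_mod⟩ := Metric.uniformContinuous_iff.1 hp_uc η hη0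
  obtain ⟨ρP, hρP, hP_mod⟩ := Metric.uniformContinuous_iff.1 hP_uc η hη0
  obtain ⟨ρr, hρr, hr_mod⟩ := Metric.uniformContinuous_iff.1 hr_uc η hη0
  set ρ₀ : ℝ := min 1 (min ρp (min ρP ρr)) with hρdef
  have hρ₀ : 0 < ρ₀ := lt_min one_pos (lt_min hρp (lt_min hρP hρr))
  have hρ₁ : ρ₀ ≤ 1 := min_le_left _ _
  have hρ₂ : ρ₀ ≤ ρp := (min_le_right _ _).trans (min_le_left _ _)
  have hρ₃ : ρ₀ ≤ ρP := (min_le_right _ _).trans ((min_le_right _ _).trans (min_le_left _ _))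
  have hρ₄ : ρ₀ ≤ ρr := (min_le_right _ _).trans ((min_le_right _ _).trans (min_le_right _ _))
  have hpball : ∀ x, ∀ y ∈ ball x ρ₀, P x - η ≤ p x y := by
    intro x y hy
    have h : dist (x, x) (x, y) < ρp := by
      rw [Prod.dist_eq]
      simpa [dist_comm x y] using (mem_ball.1 hy).trans_le hρ₂
    have := (abs_lt.1 (Real.dist_eq _ _ ▸ hp_mod h)).2
    simp only [hPdef]
    linarith
  have hPball : ∀ x, ∀ y ∈ ball x ρ₀, P x - η ≤ P y := by
    intro x y hy
    have := (abs_lt.1 (Real.dist_eq _ _ ▸ hP_mod ((mem_ball.1 hy).trans_le hρ₃))).1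
    linarith
  have hrball : ∀ x, ∀ y ∈ ball x ρ₀, r x - η ≤ r y := by
    intro x y hy
    have := (abs_lt.1 (Real.dist_eq _ _ ▸ hr_mod ((mem_ball.1 hy).trans_le hρ₄))).1
    linarith
  have hboot : ∀ k : ℕ, ∃ A : ℝ, ∀ u : EuclideanSpace ℝ (Fin N) → ℝ, Measurable u →
      modLq univ P u ≤ 1 → gagMod univ s p u ≤ 1 →
        modLq univ (fun x => min (r x) (P x + k * (κ / 2))) u ≤ ENNReal.ofReal A := by
    intro k
    induction k with
    | zero =>
      refine ⟨1, fun u _ h _ => ?_⟩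
      have : (fun x => min (r x) (P x + (0 : ℕ) * (κ / 2))) = P := by
        funext x
        simpa using hpr x
      rwa [this, ENNReal.ofReal_one]
    | succ k ih =>
      obtain ⟨A, hA⟩ := ih
      have hPσ : ∀ x, P x ≤ min (r x) (P x + k * (κ / 2)) := fun x =>
        le_min (hpr x) (le_add_of_nonneg_right (by positivity))
      obtain ⟨A', hA'⟩ := exists_modLq_le_of_modLq_le hN hs0 (p := p) (P := P)
        (σ := fun x => min (r x) (P x + k * (κ / 2)))
        (τ := fun x => min (r x) (P x + (k + 1 : ℕ) * (κ / 2)))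
        hP_uc.continuous.measurable hρ₀ hρ₁ (η := η) (T := R)
        (fun x => by linarith [hPpm x]) (fun x => by linarith [hPpm x, hPσ x])
        (fun x => by nlinarith [hsP x]) hpball
        (fun x y hy => by
          rw [sub_le_iff_le_add]
          refine (min_le_min (sub_le_iff_le_add.1 (hrball x y hy))
            (add_le_add_left (sub_le_iff_le_add.1 (hPball x y hy)) _)).trans ?_
          rw [add_right_comm, min_add_add_right])
        (fun x => by linarith [hPpm x])
        (fun x => le_min (hpr x) (le_add_of_nonneg_right (by positivity)))
        (fun x => (min_le_left _ _).trans (hrR x))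
        (fun x => by
          set σ := min (r x) (P x + k * (κ / 2)) with hσ
          have hσr : σ ≤ r x := min_le_left _ _
          have hσ0 : 0 ≤ σ := by linarith [hPpm x, hPσ x]
          have h1 : min (r x) (P x + (k + 1 : ℕ) * (κ / 2)) ≤ σ + κ / 2 := by
            rw [hσ, ← min_add_add_right]
            refine min_le_min (by linarith) (le_of_eq ?_)
            push_cast
            ring
          have h2 := hgain x σ hσr
          have h3 : s * P x / N ≤ 1 := by
            rw [div_le_one hNR]
            linarith [hsP x]
          have h4 : s * σ / N ≤ R := by
            rw [div_le_iff₀ hNR]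
            nlinarith [hrR x]
          have h5 : (P x - η) * (1 + s * (σ - η) / N) =
              P x * (1 + s * σ / N) - η * (1 + s * σ / N + s * P x / N) + s * η ^ 2 / N := by
            field_simp
            ring
          have h6 : 0 ≤ s * η ^ 2 / N := by positivity
          have h7 : η * (1 + s * σ / N + s * P x / N) ≤ η * (2 + R) :=
            mul_le_mul_of_nonneg_left (by linarith) hη0.le
          rw [h5]
          linarith) A
      exact ⟨A', fun u hu h1 h2 => hA' u hu h1 h2 (hA u hu h1 h2)⟩
  obtain ⟨k, hk⟩ := exists_nat_ge (R / (κ / 2))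
  rw [div_le_iff₀ (by positivity)] at hk
  obtain ⟨A, hA⟩ := hboot k
  have : (fun x => min (r x) (P x + k * (κ / 2))) = r := by
    funext x
    exact min_eq_left (by linarith [hrR x, hPpm x])
  exact ⟨A, this ▸ hA⟩

lemma exists_modLq_div_le_one {N : ℕ} {q : EuclideanSpace ℝ (Fin N) → ℝ} (hq : ∀ x, 1 ≤ q x)
    {u : EuclideanSpace ℝ (Fin N) → ℝ} (h : modLq univ q u < ⊤) :
    ∃ l : ℝ, 0 < l ∧ modLq univ q (fun x => u x / l) ≤ 1 := by
  set a := (modLq univ q u).toReal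
  have ha : 0 ≤ a := ENNReal.toReal_nonneg
  refine ⟨a + 1, by positivity, (modLq_div_le univ hq u (by linarith)).trans ?_⟩
  rw [← ENNReal.ofReal_toReal h.ne, ← ENNReal.ofReal_mul (by positivity), ENNReal.ofReal_le_one,
    inv_mul_le_one₀ (by positivity)]
  linarith

lemma exists_gagMod_div_lt_one {N : ℕ} {s : ℝ}
    {p : EuclideanSpace ℝ (Fin N) → EuclideanSpace ℝ (Fin N) → ℝ} (hp : ∀ x y, 1 ≤ p x y)
    {u : EuclideanSpace ℝ (Fin N) → ℝ} (h : gagMod univ s p u < ⊤) :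
    ∃ l : ℝ, 0 < l ∧ gagMod univ s p (fun x => u x / l) < 1 := by
  set a := (gagMod univ s p u).toReal
  have ha : 0 ≤ a := ENNReal.toReal_nonneg
  refine ⟨a + 1, by positivity, (gagMod_div_le univ s hp u (by linarith)).trans_lt ?_⟩
  rw [← ENNReal.ofReal_toReal h.ne, ← ENNReal.ofReal_mul (by positivity), ENNReal.ofReal_lt_one,
    inv_mul_lt_one₀ (by positivity)]
  linarith

/-- **Theorem 3.7 (i): continuous embedding on `ℝ^N`.** Let `s ∈ (0,1)` and let `p` be a
uniformly continuous symmetric exponent on `ℝ^N × ℝ^N` with `1 < p⁻ ≤ p⁺ < ∞` and `s p⁺ < N`.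
If `r` is uniformly continuous with `1 < inf r ≤ sup r < ∞`, `p(x,x) ≤ r(x)` everywhere and
`inf (p*_s − r) > 0`, then `W^{s,p(·,·)}(ℝ^N) ↪ L^{r(·)}(ℝ^N)` continuously. -/
theorem stmt_2 {N : ℕ}
    (s : ℝ) (hs0 : 0 < s) (hs1 : s < 1)
    (p : EuclideanSpace ℝ (Fin N) → EuclideanSpace ℝ (Fin N) → ℝ)
    (hp_uc : UniformContinuous
      (fun z : EuclideanSpace ℝ (Fin N) × EuclideanSpace ℝ (Fin N) => p z.1 z.2))
    (hp_symm : ∀ x y, p x y = p y x)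
    (pm pM : ℝ)
    (hpm : pm = sInf (Set.range
      fun z : EuclideanSpace ℝ (Fin N) × EuclideanSpace ℝ (Fin N) => p z.1 z.2))
    (hpM : pM = sSup (Set.range
      fun z : EuclideanSpace ℝ (Fin N) × EuclideanSpace ℝ (Fin N) => p z.1 z.2))
    (hp_lb : 1 < pm)
    (hp_bddAbove : BddAbove (Set.range
      fun z : EuclideanSpace ℝ (Fin N) × EuclideanSpace ℝ (Fin N) => p z.1 z.2))
    (hp_ub : s * pM < N)
    (r : EuclideanSpace ℝ (Fin N) → ℝ) (hr_uc : UniformContinuous r)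
    (hr_lb : 1 < sInf (Set.range r)) (hr_bddAbove : BddAbove (Set.range r))
    (hpr : ∀ x, p x x ≤ r x)
    (hgap : ∃ δ : ℝ, 0 < δ ∧ ∀ x, r x + δ ≤ N * p x x / (N - s * p x x)) :
    ∃ C : ℝ, 0 < C ∧ ∀ u : EuclideanSpace ℝ (Fin N) → ℝ,
      memW Set.univ (fun x => p x x) s p u →
        luxNorm Set.univ r u ≤ C * sobNorm Set.univ (fun x => p x x) s p u := by
  have hp_bddBelow : BddBelow (Set.range
      fun z : EuclideanSpace ℝ (Fin N) × EuclideanSpace ℝ (Fin N) => p z.1 z.2) := by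
    by_contra h
    rw [Real.sInf_of_not_bddBelow h] at hpm
    linarith
  have hple : ∀ x y, pm ≤ p x y := fun x y => hpm ▸ csInf_le hp_bddBelow ⟨(x, y), rfl⟩
  have hpge : ∀ x y, p x y ≤ pM := fun x y => hpM ▸ le_csSup hp_bddAbove ⟨(x, y), rfl⟩
  have hp1 : ∀ x y, 1 ≤ p x y := fun x y => hp_lb.le.trans (hple x y)
  have hN : 0 < N := by
    have h1 : 0 < s * pM := mul_pos hs0 (by linarith [hple 0 0, hpge 0 0])
    exact_mod_cast h1.trans hp_ub
  obtain ⟨δ, hδ, hgap⟩ := hgap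
  obtain ⟨R, hR⟩ := hr_bddAbove
  obtain ⟨A, hA⟩ := exists_modLq_le hN hs0 hs1 hp_uc hp_lb hple hpge hp_ub hr_uc
    (fun x => hR ⟨x, rfl⟩) hpr hδ hgap
  have hC : 1 ≤ max 1 A := le_max_left _ _
  have hC0 : 0 < max 1 A := by linarith
  refine ⟨max 1 A, hC0, fun u ⟨hu, hu1, hu2⟩ => ?_⟩
  have key : ∀ l₁ l₂ : ℝ, 0 < l₁ → modLq univ (fun x => p x x) (fun x => u x / l₁) ≤ 1 →
      0 < l₂ → gagMod univ s p (fun x => u x / l₂) < 1 →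
      luxNorm univ r u ≤ max 1 A * (l₁ + l₂) := by
    intro l₁ l₂ hl₁ h₁ hl₂ h₂
    refine csInf_le ⟨0, fun l hl => hl.1.le⟩ ⟨by positivity, ?_⟩
    have e : ∀ l, 0 < l → (fun x => u x / (l₁ + l₂)) = fun x => u x / l / ((l₁ + l₂) / l) := by
      intro l hl
      funext x
      field_simp
    have h₁' : modLq univ (fun x => p x x) (fun x => u x / (l₁ + l₂)) ≤ 1 := by
      have hl : 1 ≤ (l₁ + l₂) / l₁ := by rw [one_le_div hl₁]; linarith
      rw [e l₁ hl₁]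
      refine (modLq_div_le univ (fun x => hp1 x x) _ hl).trans ?_
      exact mul_le_one' (ENNReal.ofReal_le_one.2 (inv_le_one_of_one_le₀ hl)) h₁
    have h₂' : gagMod univ s p (fun x => u x / (l₁ + l₂)) ≤ 1 := by
      have hl : 1 ≤ (l₁ + l₂) / l₂ := by rw [one_le_div hl₂]; linarith
      rw [e l₂ hl₂]
      refine (gagMod_div_le univ s hp1 _ hl).trans ?_
      exact mul_le_one' (ENNReal.ofReal_le_one.2 (inv_le_one_of_one_le₀ hl)) h₂.le
    have h := hA _ (hu.div_const _) h₁' h₂'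
    have e' : (fun x => u x / (max 1 A * (l₁ + l₂))) = fun x => u x / (l₁ + l₂) / max 1 A := by
      funext x
      rw [div_div, mul_comm]
    rw [e']
    refine (modLq_div_le univ (fun x => (hp1 x x).trans (hpr x)) _ hC).trans ?_
    calc _ ≤ ENNReal.ofReal (max 1 A)⁻¹ * ENNReal.ofReal (max 1 A) := by
          gcongr
          exact h.trans (ENNReal.ofReal_le_ofReal (le_max_right _ _))
      _ = 1 := by
          rw [← ENNReal.ofReal_mul (by positivity), inv_mul_cancel₀ hC0.ne', ENNReal.ofReal_one]
  have h1 : ∀ l₂ : ℝ, 0 < l₂ → gagMod univ s p (fun x => u x / l₂) < 1 →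
      luxNorm univ r u / max 1 A - l₂ ≤ luxNorm univ (fun x => p x x) u := by
    intro l₂ hl₂ h₂
    refine le_csInf (exists_modLq_div_le_one (fun x => hp1 x x) hu1) fun l₁ hl₁ => ?_
    rw [sub_le_iff_le_add, div_le_iff₀' hC0]
    exact key l₁ l₂ hl₁.1 hl₁.2 hl₂ h₂
  have h2 : luxNorm univ r u / max 1 A - luxNorm univ (fun x => p x x) u ≤
      gagSeminorm univ s p u := by
    refine le_csInf (exists_gagMod_div_lt_one hp1 hu2) fun l₂ hl₂ => ?_
    linarith [h1 l₂ hl₂.1 hl₂.2]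
  rw [sub_le_iff_le_add', div_le_iff₀' hC0] at h2
  exact h2
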